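/- Properties of the discretization: for every μ ∈ M(T), (i) ‖μⁿ‖_{TV} ≤ ‖μ‖_{TV} for all n; (ii) for every f ∈ C(T), ⟨μⁿ, f⟩ → ⟨μ, f⟩ as n → ∞ (weak* convergence of μⁿ to μ); (iii) if f = 𝒦ν for some ν ∈ M(T) and (μ_θ)_{θ∈Θ} is a family in M(T) with sup_{θ∈Θ} ‖μ_θ‖_{TV} < ∞, then sup_{θ∈Θ} |⟨μ_θⁿ − μ_θ, f⟩| → 0 as n → ∞; (iv) sup{ |⟨νⁿ, 𝒦μⁿ⟩ − ⟨ν, 𝒦μ⟩| : μ, ν ∈ M(T), ‖μ‖_{TV} ≤ 1, ‖ν‖_{TV} ≤ 1 } → 0 as n → ∞. -/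

import Mathlib

open Filter MeasureTheory ProbabilityTheory Topology

noncomputable section

/-- The Dirac measure at `x`, as a bounded linear functional on `C([a,b])`. -/
def dirac {a b : ℝ} (x : Set.Icc a b) : C(Set.Icc a b, ℝ) →L[ℝ] ℝ :=
  LinearMap.mkContinuous
    { toFun := fun f => f x
      map_add' := by intro f g; simp
      map_smul' := by intro c f; simp }
    1 (fun f => by simpa using f.norm_coe_le_norm x)

/-- Continuous functions converging pointwise (as `k → ∞`) to the indicator of `[a,u]`. -/
def gbump (a b u : ℝ) (k : ℕ) : C(Set.Icc a b, ℝ) :=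
  ⟨fun x => max 0 (min 1 (1 - k * (x.1 - u))), by fun_prop⟩

/-- The coefficients `μ(Tᵢ)` of the discretization of `μ`, via the cumulative distribution
function `F μ u = μ([a,u])`. -/
def coef {a b : ℝ} (F : (C(Set.Icc a b, ℝ) →L[ℝ] ℝ) → ℝ → ℝ) (t : ℕ → ℕ → Set.Icc a b)
    (n : ℕ) (μ : C(Set.Icc a b, ℝ) →L[ℝ] ℝ) (i : ℕ) : ℝ :=
  if i = 1 then F μ (t n 1) else F μ (t n i) - F μ (t n (i - 1))

/-- The discretized measure `μⁿ = ∑ᵢ μ(Tᵢ) δ_{tᵢ}`. -/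
def muDisc {a b : ℝ} (F : (C(Set.Icc a b, ℝ) →L[ℝ] ℝ) → ℝ → ℝ) (t : ℕ → ℕ → Set.Icc a b)
    (n : ℕ) (μ : C(Set.Icc a b, ℝ) →L[ℝ] ℝ) : C(Set.Icc a b, ℝ) →L[ℝ] ℝ :=
  ∑ i ∈ Finset.Icc 1 n, coef F t n μ i • dirac (t n i)

/-- The continuous approximation at scale `k` of the indicator of the `i`-th partition cell. -/
def cellBump {a b : ℝ} (s : ℕ → Set.Icc a b) (k i : ℕ) : C(Set.Icc a b, ℝ) :=
  if i = 1 then gbump a b (s 1) k else gbump a b (s i) k - gbump a b (s (i - 1)) k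

lemma gbump_apply {a b : ℝ} (u : ℝ) (k : ℕ) (x : Set.Icc a b) :
    gbump a b u k x = max 0 (min 1 (1 - k * (x.1 - u))) := rfl

lemma gbump_nonneg {a b : ℝ} (u : ℝ) (k : ℕ) (x : Set.Icc a b) : 0 ≤ gbump a b u k x :=
  le_max_left _ _

lemma gbump_mono {a b u v : ℝ} (huv : u ≤ v) (k : ℕ) (x : Set.Icc a b) :
    gbump a b u k x ≤ gbump a b v k x := by
  simp only [gbump_apply]
  gcongr

lemma gbump_eq_one {a b u : ℝ} {x : Set.Icc a b} (hx : x.1 ≤ u) (k : ℕ) :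
    gbump a b u k x = 1 := by
  have h : (k : ℝ) * (x.1 - u) ≤ 0 :=
    mul_nonpos_of_nonneg_of_nonpos (Nat.cast_nonneg k) (sub_nonpos.mpr hx)
  rw [gbump_apply, min_eq_left (by linarith), max_eq_right zero_le_one]

lemma gbump_eq_zero {a b u : ℝ} {k : ℕ} {x : Set.Icc a b} (hx : 1 ≤ k * (x.1 - u)) :
    gbump a b u k x = 0 := by
  rw [gbump_apply]
  exact max_eq_left ((min_le_right _ _).trans (by linarith))

lemma sum_cellBump {a b : ℝ} (s : ℕ → Set.Icc a b) (k n : ℕ) (hn : 1 ≤ n) :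
    ∑ i ∈ Finset.Icc 1 n, cellBump s k i = gbump a b (s n) k := by
  induction n, hn using Nat.le_induction with
  | base => simp [cellBump]
  | succ m hm ih =>
    rw [Finset.sum_Icc_succ_top (by omega), ih, cellBump, if_neg (by omega), Nat.add_sub_cancel]
    abel

lemma cellBump_nonneg {a b : ℝ} {s : ℕ → Set.Icc a b} {n i : ℕ}
    (hs : ∀ i < n, (s i : ℝ) < s (i + 1)) (hi : i ∈ Finset.Icc 1 n) (k : ℕ) (x : Set.Icc a b) :
    0 ≤ cellBump s k i x := by
  obtain ⟨h1, hin⟩ := Finset.mem_Icc.mp hi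
  unfold cellBump
  split_ifs with h
  · exact gbump_nonneg _ _ _
  · have hlt := hs (i - 1) (by omega)
    rw [Nat.sub_add_cancel h1] at hlt
    exact sub_nonneg.mpr (gbump_mono hlt.le k x)

lemma mem_of_cellBump_ne_zero {a b : ℝ} {s : ℕ → Set.Icc a b} {k i : ℕ} {x : Set.Icc a b}
    (hs0 : (s 0 : ℝ) = a) (hlt : (s (i - 1) : ℝ) ≤ s i) (hx : cellBump s k i x ≠ 0) :
    (s (i - 1) : ℝ) ≤ x ∧ k * (x.1 - s i) < 1 := by
  unfold cellBump at hx
  split_ifs at hx with h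
  · subst h
    refine ⟨by simpa [hs0] using x.2.1, ?_⟩
    by_contra! hc
    exact hx (gbump_eq_zero hc)
  · rw [ContinuousMap.sub_apply] at hx
    constructor
    · by_contra! hc
      exact hx (by rw [gbump_eq_one hc.le, gbump_eq_one (hc.le.trans hlt), sub_self])
    · by_contra! hc
      have hle := gbump_mono hlt k x
      rw [gbump_eq_zero hc] at hx hle
      exact hx (by rw [le_antisymm hle (gbump_nonneg _ _ _), sub_zero])

lemma tendsto_cellBump {a b : ℝ} {t : ℕ → ℕ → Set.Icc a b}
    {F : (C(Set.Icc a b, ℝ) →L[ℝ] ℝ) → ℝ → ℝ}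
    (hF : ∀ (μ : C(Set.Icc a b, ℝ) →L[ℝ] ℝ) (u : ℝ),
      Tendsto (fun k : ℕ => μ (gbump a b u k)) atTop (𝓝 (F μ u)))
    (μ : C(Set.Icc a b, ℝ) →L[ℝ] ℝ) (n i : ℕ) :
    Tendsto (fun k => μ (cellBump (t n) k i)) atTop (𝓝 (coef F t n μ i)) := by
  unfold cellBump coef
  split_ifs with h
  · exact hF μ _
  · simpa only [map_sub] using (hF μ (t n i)).sub (hF μ (t n (i - 1)))

lemma abs_muDisc_sub_le {a b : ℝ} {t : ℕ → ℕ → Set.Icc a b}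
    {F : (C(Set.Icc a b, ℝ) →L[ℝ] ℝ) → ℝ → ℝ}
    (hF : ∀ (μ : C(Set.Icc a b, ℝ) →L[ℝ] ℝ) (u : ℝ),
      Tendsto (fun k : ℕ => μ (gbump a b u k)) atTop (𝓝 (F μ u)))
    {n : ℕ} (hn : 1 ≤ n) (hlast : (t n n : ℝ) = b)
    (hmono : ∀ i < n, (t n i : ℝ) < t n (i + 1))
    (μ : C(Set.Icc a b, ℝ) →L[ℝ] ℝ) {f h : C(Set.Icc a b, ℝ)} {ε : ℝ} (hε : 0 ≤ ε)
    (hfh : ∀ᶠ k in atTop, ∀ i ∈ Finset.Icc 1 n, ∀ x,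
      cellBump (t n) k i x ≠ 0 → |f (t n i) - h x| ≤ ε) :
    |muDisc F t n μ f - μ h| ≤ ‖μ‖ * ε := by
  have hlim : Tendsto
      (fun k => μ (∑ i ∈ Finset.Icc 1 n, f (t n i) • cellBump (t n) k i - h)) atTop
      (𝓝 (muDisc F t n μ f - μ h)) := by
    have hsum : muDisc F t n μ f = ∑ i ∈ Finset.Icc 1 n, f (t n i) * coef F t n μ i := by
      simp only [muDisc, sum_apply, smul_apply, smul_eq_mul]
      exact Finset.sum_congr rfl fun i _ => mul_comm _ _
    rw [hsum]
    simp only [map_sub, map_sum, map_smul, smul_eq_mul]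
    exact (tendsto_finsetSum _ fun i _ => (tendsto_cellBump hF μ n i).const_mul _).sub_const _
  refine le_of_tendsto hlim.abs ?_
  filter_upwards [hfh] with k hk
  refine (μ.le_opNorm _).trans (mul_le_mul_of_nonneg_left ?_ (norm_nonneg _))
  refine (ContinuousMap.norm_le _ hε).mpr fun x => ?_
  have hone : ∑ i ∈ Finset.Icc 1 n, cellBump (t n) k i x = 1 := by
    rw [← ContinuousMap.sum_apply, sum_cellBump _ _ _ hn]
    exact gbump_eq_one (x.2.2.trans_eq hlast.symm) k
  have hexp : (∑ i ∈ Finset.Icc 1 n, f (t n i) • cellBump (t n) k i - h) x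
      = ∑ i ∈ Finset.Icc 1 n, (f (t n i) - h x) * cellBump (t n) k i x := by
    simp only [sub_mul, Finset.sum_sub_distrib, ← Finset.mul_sum, hone, mul_one,
      ContinuousMap.sub_apply, ContinuousMap.sum_apply, ContinuousMap.smul_apply, smul_eq_mul]
  rw [hexp, Real.norm_eq_abs]
  calc |∑ i ∈ Finset.Icc 1 n, (f (t n i) - h x) * cellBump (t n) k i x|
      ≤ ∑ i ∈ Finset.Icc 1 n, |(f (t n i) - h x) * cellBump (t n) k i x| :=
        Finset.abs_sum_le_sum_abs _ _
    _ ≤ ∑ i ∈ Finset.Icc 1 n, ε * cellBump (t n) k i x := by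
        refine Finset.sum_le_sum fun i hi => ?_
        have hpos := cellBump_nonneg hmono hi k x
        rw [abs_mul, abs_of_nonneg hpos]
        by_cases h0 : cellBump (t n) k i x = 0
        · simp [h0]
        · exact mul_le_mul_of_nonneg_right (hk i hi x h0) hpos
    _ = ε := by rw [← Finset.mul_sum, hone, mul_one]

lemma norm_muDisc_le {a b : ℝ} {t : ℕ → ℕ → Set.Icc a b}
    {F : (C(Set.Icc a b, ℝ) →L[ℝ] ℝ) → ℝ → ℝ}
    (hF : ∀ (μ : C(Set.Icc a b, ℝ) →L[ℝ] ℝ) (u : ℝ),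
      Tendsto (fun k : ℕ => μ (gbump a b u k)) atTop (𝓝 (F μ u)))
    {n : ℕ} (hlast : 1 ≤ n → (t n n : ℝ) = b)
    (hmono : ∀ i < n, (t n i : ℝ) < t n (i + 1))
    (μ : C(Set.Icc a b, ℝ) →L[ℝ] ℝ) : ‖muDisc F t n μ‖ ≤ ‖μ‖ := by
  refine ContinuousLinearMap.opNorm_le_bound _ μ.opNorm_nonneg fun f => ?_
  rcases Nat.eq_zero_or_pos n with rfl | hn
  · simpa [muDisc] using mul_nonneg μ.opNorm_nonneg (norm_nonneg f)
  · have := abs_muDisc_sub_le (f := f) (h := 0) hF hn (hlast hn) hmono μ (norm_nonneg f)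
      (Eventually.of_forall fun k i _ x _ => by simpa using f.norm_coe_le_norm (t n i))
    simpa using this

lemma abs_muDisc_sub_le_of_mesh {a b : ℝ} {t : ℕ → ℕ → Set.Icc a b}
    {F : (C(Set.Icc a b, ℝ) →L[ℝ] ℝ) → ℝ → ℝ}
    (hF : ∀ (μ : C(Set.Icc a b, ℝ) →L[ℝ] ℝ) (u : ℝ),
      Tendsto (fun k : ℕ => μ (gbump a b u k)) atTop (𝓝 (F μ u)))
    {n : ℕ} (hn : 1 ≤ n) (hfirst : (t n 0 : ℝ) = a) (hlast : (t n n : ℝ) = b)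
    (hmono : ∀ i < n, (t n i : ℝ) < t n (i + 1))
    {δ : ℝ} (hδ : 0 < δ) (hmesh : ∀ i < n, (t n (i + 1) : ℝ) - t n i < δ)
    (μ : C(Set.Icc a b, ℝ) →L[ℝ] ℝ) {f : C(Set.Icc a b, ℝ)} {ε : ℝ} (hε : 0 ≤ ε)
    (hf : ∀ x y, dist x y < δ → |f x - f y| ≤ ε) :
    |muDisc F t n μ f - μ f| ≤ ‖μ‖ * ε := by
  refine abs_muDisc_sub_le hF hn hlast hmono μ hε ?_
  obtain ⟨k₀, hk₀⟩ := exists_nat_gt (1 / δ)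
  filter_upwards [eventually_ge_atTop k₀] with k hk i hi x hx
  obtain ⟨h1, hin⟩ := Finset.mem_Icc.mp hi
  have hlt := hmono (i - 1) (by omega)
  have hm := hmesh (i - 1) (by omega)
  rw [Nat.sub_add_cancel h1] at hlt hm
  obtain ⟨hl, hr⟩ := mem_of_cellBump_ne_zero hfirst hlt.le hx
  have hkδ : 1 < (k : ℝ) * δ :=
    (div_lt_iff₀ hδ).mp (hk₀.trans_le (Nat.cast_le.mpr hk))
  have hxr : x.1 - t n i < δ := lt_of_mul_lt_mul_left (hr.trans hkδ) (Nat.cast_nonneg k)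
  refine hf _ _ ?_
  rw [Subtype.dist_eq, Real.dist_eq, abs_sub_lt_iff]
  exact ⟨by linarith, hxr⟩

/-- Lemma C.4 / `convergence of discret.mu`, properties of the
discretization `μⁿ = ∑ᵢ μ(Tᵢ)δ_{tᵢ}`: (i) `‖μⁿ‖_{TV} ≤ ‖μ‖_{TV}` for all `n`;
(ii) `⟨μⁿ, f⟩ → ⟨μ, f⟩` for every `f ∈ C(T)` (weak* convergence);
(iii) if `f = 𝒦ν` and `(μ_θ)_θ` is a family that is bounded in total variation, then
`sup_θ |⟨μ_θⁿ − μ_θ, f⟩| → 0`;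
(iv) `sup{ |⟨νⁿ, 𝒦μⁿ⟩ − ⟨ν, 𝒦μ⟩| : ‖μ‖ ≤ 1, ‖ν‖ ≤ 1 } → 0` (i.e. `‖𝒦ⁿ − 𝒦‖_op → 0`). -/
theorem stmt19 {a b : ℝ} (hab : a < b)
    (K : C(Set.Icc a b × Set.Icc a b, ℝ))
    (hKsymm : ∀ s t : Set.Icc a b, K (s, t) = K (t, s))
    (Kop : (C(Set.Icc a b, ℝ) →L[ℝ] ℝ) →L[ℝ] C(Set.Icc a b, ℝ))
    (hKop : ∀ (μ : C(Set.Icc a b, ℝ) →L[ℝ] ℝ) (s : Set.Icc a b), Kop μ s = μ (K.curry s))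
    (hpos : ∀ μ : C(Set.Icc a b, ℝ) →L[ℝ] ℝ, 0 ≤ μ (Kop μ))
    (hsym : ∀ μ ν : C(Set.Icc a b, ℝ) →L[ℝ] ℝ, μ (Kop ν) = ν (Kop μ))
    -- the partitions `0 = t n 0 < t n 1 < ⋯ < t n n = max T` with vanishing mesh
    (t : ℕ → ℕ → Set.Icc a b)
    (ht0 : ∀ n, 1 ≤ n → (t n 0 : ℝ) = a)
    (htlast : ∀ n, 1 ≤ n → (t n n : ℝ) = b)
    (htmono : ∀ n, 1 ≤ n → ∀ i < n, (t n i : ℝ) < (t n (i + 1) : ℝ))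
    (hmesh : ∀ δ > (0 : ℝ), ∃ N, ∀ n ≥ N, ∀ i < n, (t n (i + 1) : ℝ) - (t n i : ℝ) < δ)
    -- `F μ u = μ([a,u])`, the cumulative distribution function of `μ`
    (F : (C(Set.Icc a b, ℝ) →L[ℝ] ℝ) → ℝ → ℝ)
    (hF : ∀ (μ : C(Set.Icc a b, ℝ) →L[ℝ] ℝ) (u : ℝ),
      Tendsto (fun k : ℕ => μ (gbump a b u k)) atTop (𝓝 (F μ u)))
    -- a family of measures, bounded in total variation, for part (iii)
    {ι : Type*} (μfam : ι → (C(Set.Icc a b, ℝ) →L[ℝ] ℝ)) (C : ℝ)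
    (hC : ∀ i, ‖μfam i‖ ≤ C) :
    (∀ (μ : C(Set.Icc a b, ℝ) →L[ℝ] ℝ) (n : ℕ), ‖muDisc F t n μ‖ ≤ ‖μ‖) ∧
      (∀ (μ : C(Set.Icc a b, ℝ) →L[ℝ] ℝ) (f : C(Set.Icc a b, ℝ)),
        Tendsto (fun n => (muDisc F t n μ) f) atTop (𝓝 (μ f))) ∧
        (∀ ν : C(Set.Icc a b, ℝ) →L[ℝ] ℝ, ∀ δ > (0 : ℝ), ∃ N, ∀ n ≥ N, ∀ i,
          |(muDisc F t n (μfam i) - μfam i) (Kop ν)| < δ) ∧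
          ∀ δ > (0 : ℝ), ∃ N, ∀ n ≥ N, ∀ μ ν : C(Set.Icc a b, ℝ) →L[ℝ] ℝ,
            ‖μ‖ ≤ 1 → ‖ν‖ ≤ 1 →
              |(muDisc F t n ν) (Kop (muDisc F t n μ)) - ν (Kop μ)| < δ := by
  have hmono' : ∀ n, ∀ i < n, (t n i : ℝ) < t n (i + 1) := fun n i hi =>
    htmono n (by omega) i hi
  have hnorm : ∀ (μ : C(Set.Icc a b, ℝ) →L[ℝ] ℝ) (n : ℕ), ‖muDisc F t n μ‖ ≤ ‖μ‖ := fun μ n =>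
    norm_muDisc_le hF (htlast n) (hmono' n) μ
  have key : ∀ δ > (0 : ℝ), ∃ N, ∀ n ≥ N, ∀ (μ : C(Set.Icc a b, ℝ) →L[ℝ] ℝ)
      (f : C(Set.Icc a b, ℝ)) (ε : ℝ), 0 ≤ ε → (∀ x y, dist x y < δ → |f x - f y| ≤ ε) →
      |muDisc F t n μ f - μ f| ≤ ‖μ‖ * ε := by
    intro δ hδ
    obtain ⟨N, hN⟩ := hmesh δ hδ
    refine ⟨max N 1, fun n hn μ f ε hε hf => ?_⟩
    have hn1 : 1 ≤ n := (le_max_right _ _).trans hn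
    exact abs_muDisc_sub_le_of_mesh hF hn1 (ht0 n hn1) (htlast n hn1) (hmono' n) hδ
      (hN n ((le_max_left _ _).trans hn)) μ hε hf
  have hunif : ∀ (f : C(Set.Icc a b, ℝ)) (B : ℝ), ∀ ε > (0 : ℝ), ∃ N, ∀ n ≥ N,
      ∀ μ : C(Set.Icc a b, ℝ) →L[ℝ] ℝ, ‖μ‖ ≤ B → |muDisc F t n μ f - μ f| < ε := by
    intro f B ε hε
    have hB : 0 < |B| + 1 := by positivity
    obtain ⟨δ, hδ, hfδ⟩ := Metric.uniformContinuous_iff.mp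
      (CompactSpace.uniformContinuous_of_continuous f.continuous) (ε / (|B| + 1)) (by positivity)
    obtain ⟨N, hN⟩ := key δ hδ
    refine ⟨N, fun n hn μ hμ => ?_⟩
    calc |muDisc F t n μ f - μ f| ≤ ‖μ‖ * (ε / (|B| + 1)) :=
          hN n hn μ f _ (by positivity) fun x y hxy => (hfδ hxy).le
      _ < (|B| + 1) * (ε / (|B| + 1)) := by
          gcongr
          linarith [le_abs_self B]
      _ = ε := by field_simp
  refine ⟨hnorm, fun μ f => ?_, fun ν δ hδ => ?_, fun δ hδ => ?_⟩
  · refine Metric.tendsto_atTop.mpr fun ε hε => ?_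
    obtain ⟨N, hN⟩ := hunif f ‖μ‖ ε hε
    exact ⟨N, fun n hn => hN n hn μ le_rfl⟩
  · obtain ⟨N, hN⟩ := hunif (Kop ν) C δ hδ
    exact ⟨N, fun n hn i => hN n hn (μfam i) (hC i)⟩
  · obtain ⟨η, hη, hKη⟩ := Metric.uniformContinuous_iff.mp
      (CompactSpace.uniformContinuous_of_continuous K.curry.continuous) (δ / 3) (by positivity)
    have hequi : ∀ μ : C(Set.Icc a b, ℝ) →L[ℝ] ℝ, ‖μ‖ ≤ 1 → ∀ x y, dist x y < η →
        |Kop μ x - Kop μ y| ≤ δ / 3 := by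
      intro μ hμ x y hxy
      rw [hKop, hKop, ← map_sub]
      refine (μ.le_of_opNorm_le hμ _).trans ?_
      rw [one_mul, ← dist_eq_norm]
      exact (hKη hxy).le
    obtain ⟨N, hN⟩ := key η hη
    have hN' : ∀ n ≥ N, ∀ μ ν : C(Set.Icc a b, ℝ) →L[ℝ] ℝ, ‖μ‖ ≤ 1 → ‖ν‖ ≤ 1 →
        |muDisc F t n ν (Kop μ) - ν (Kop μ)| ≤ δ / 3 := fun n hn μ ν hμ hν =>
      (hN n hn ν (Kop μ) (δ / 3) (by positivity) (hequi μ hμ)).trans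
        (mul_le_of_le_one_left (by positivity) hν)
    refine ⟨N, fun n hn μ ν hμ hν => ?_⟩
    have h₁ := hN' n hn (muDisc F t n μ) ν ((hnorm μ n).trans hμ) hν
    have h₂ := hN' n hn ν μ hν hμ
    rw [hsym ν] at h₁
    rw [hsym ν μ]
    calc _ ≤ _ := abs_sub_le _ (muDisc F t n μ (Kop ν)) _
      _ < δ := by linarith
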